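/- arXiv:2107.01673 — 5 statements merged into one kernel-verified Lean document; each statement's English description precedes it below -/
import Mathlib

section
/- Let (Ω, μ) be a probability space and let (X_v)_{v : Fin n} be Boolean random variables that are pairwise independent, with μ(X_v = true) = (√5 − 1)/2 for every v. Let C be a clause (a finite set of literals containing at most one literal per variable) such that either C consists of a single positive literal, or C contains at least two literals. Then the probability that the random assignment v ↦ X_v satisfies C is at least (√5 − 1)/2. -/
open MeasureTheory

/-- An assignment `φ` satisfies a clause (finite set of literals) if it makes
some literal `(v, s)` of the clause evaluate correctly, i.e. `φ v = s`. -/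
def SatClause {n : ℕ} (φ : Fin n → Bool) (C : Finset (Fin n × Bool)) : Prop :=
  ∃ l ∈ C, φ l.1 = l.2

/-- A clause contains at most one literal per variable. -/
def ClauseOK {n : ℕ} (C : Finset (Fin n × Bool)) : Prop :=
  ∀ (v : Fin n) (s s' : Bool), (v, s) ∈ C → (v, s') ∈ C → s = s'

/-- The number `(√5 - 1) / 2` is nonnegative. -/
lemma goldenRatio_inv_nonneg : 0 ≤ (Real.sqrt 5 - 1) / 2 := by
  have h : (1 : ℝ) ≤ Real.sqrt 5 := Real.one_le_sqrt.mpr (by norm_num)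
  linarith

/-- The number `(√5 - 1) / 2` is a root of `x + x * x = 1`. -/
lemma add_mul_self_goldenRatio_inv :
    (Real.sqrt 5 - 1) / 2 + (Real.sqrt 5 - 1) / 2 * ((Real.sqrt 5 - 1) / 2) = 1 := by
  have h : Real.sqrt 5 * Real.sqrt 5 = 5 := Real.mul_self_sqrt (by norm_num)
  linear_combination h / 4

theorem stmt_1 {n : ℕ} {Ω : Type*} [MeasurableSpace Ω]
    (μ : Measure Ω) [IsProbabilityMeasure μ]
    (X : Fin n → Ω → Bool)
    (hpair : ∀ v w : Fin n, v ≠ w → ∀ a b : Bool,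
      μ {ω | X v ω = a ∧ X w ω = b} = μ {ω | X v ω = a} * μ {ω | X w ω = b})
    (hp : ∀ v : Fin n, μ {ω | X v ω = true} = ENNReal.ofReal ((Real.sqrt 5 - 1) / 2))
    (C : Finset (Fin n × Bool)) (hok : ClauseOK C)
    (hC : (∃ v : Fin n, C = {(v, true)}) ∨ 2 ≤ C.card) :
    ENNReal.ofReal ((Real.sqrt 5 - 1) / 2) ≤ μ {ω | SatClause (fun v => X v ω) C} := by
  have mono_of_mem : ∀ v, (v, true) ∈ C →
      ENNReal.ofReal ((Real.sqrt 5 - 1) / 2) ≤ μ {ω | SatClause (fun v => X v ω) C} := by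
    intro v hv
    rw [← hp v]
    exact measure_mono fun ω hω => ⟨(v, true), hv, hω⟩
  by_cases hpos : ∃ v, (v, true) ∈ C
  · obtain ⟨v, hv⟩ := hpos
    exact mono_of_mem v hv
  rcases hC with ⟨v, rfl⟩ | hcard
  · exact mono_of_mem v (Finset.mem_singleton_self _)
  obtain ⟨⟨v, s⟩, hv, ⟨w, t⟩, hw, hne⟩ := Finset.one_lt_card.mp hcard
  obtain rfl : s = false := Bool.eq_false_iff.mpr fun h => hpos ⟨v, h ▸ hv⟩
  obtain rfl : t = false := Bool.eq_false_iff.mpr fun h => hpos ⟨w, h ▸ hw⟩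
  have hvw : v ≠ w := fun h => hne (by rw [h])
  have hcover : (1 : ENNReal) ≤
      μ {ω | SatClause (fun v => X v ω) C} + μ {ω | X v ω = true ∧ X w ω = true} := by
    rw [← measure_univ (μ := μ)]
    refine (measure_mono fun ω _ => ?_).trans (measure_union_le _ _)
    by_cases h₁ : X v ω = true
    · by_cases h₂ : X w ω = true
      · exact Or.inr ⟨h₁, h₂⟩
      · exact Or.inl ⟨(w, false), hw, Bool.eq_false_iff.mpr h₂⟩
    · exact Or.inl ⟨(v, false), hv, Bool.eq_false_iff.mpr h₁⟩
  have hnonneg := goldenRatio_inv_nonneg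
  rw [← ENNReal.ofReal_one, ← add_mul_self_goldenRatio_inv,
    ENNReal.ofReal_add hnonneg (mul_self_nonneg _), hpair v w hvw, hp, hp,
    ← ENNReal.ofReal_mul hnonneg] at hcover
  exact (ENNReal.add_le_add_iff_right ENNReal.ofReal_ne_top).mp hcover
end

section
/- Let F be a CNF formula over Fin n with m clauses, where each clause is a nonempty finite set of literals containing at most one literal per variable, and every unit clause of F is a positive literal. Let (Ω, μ) be a probability space and (X_v)_{v : Fin n} Boolean random variables that are pairwise independent with μ(X_v = true) = (√5 − 1)/2 for every v. Then the expected number of clauses of F satisfied by the random assignment v ↦ X_v is at least ((√5 − 1)/2)·m. -/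
open MeasureTheory

instance {n : ℕ} (φ : Fin n → Bool) (C : Finset (Fin n × Bool)) :
    Decidable (SatClause φ C) :=
  inferInstanceAs (Decidable (∃ l ∈ C, φ l.1 = l.2))

/-- The number of clauses of the CNF formula `F` (with multiplicity) satisfied by `φ`. -/
def satCount {n : ℕ} (φ : Fin n → Bool) (F : Multiset (Finset (Fin n × Bool))) : ℕ :=
  Multiset.countP (SatClause φ) F

/-- The set of outcomes at which a random assignment satisfies a fixed clause is measurable. -/
theorem measurableSet_satClause {n : ℕ} {Ω : Type*} [MeasurableSpace Ω] {X : Fin n → Ω → Bool}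
    (hX : ∀ v, Measurable (X v)) (C : Finset (Fin n × Bool)) :
    MeasurableSet {ω | SatClause (fun v => X v ω) C} :=
  measurable_pi_lambda (fun ω v => X v ω) hX
    (Set.toFinite {φ : Fin n → Bool | SatClause φ C}).measurableSet

theorem satCount_cons {n : ℕ} (φ : Fin n → Bool) (C : Finset (Fin n × Bool))
    (F : Multiset (Finset (Fin n × Bool))) :
    satCount φ (C ::ₘ F) = satCount φ F + if SatClause φ C then 1 else 0 :=
  Multiset.countP_cons _ _ _

/-- Linearity of expectation: if every clause is satisfied with probability at least `p`, then
the expected number of satisfied clauses is at least `p` times the number of clauses. -/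
theorem mul_card_le_integral_satCount {n : ℕ} {Ω : Type*} [MeasurableSpace Ω] (μ : Measure Ω)
    [IsProbabilityMeasure μ] {X : Fin n → Ω → Bool} (hX : ∀ v, Measurable (X v)) (p : ℝ)
    (F : Multiset (Finset (Fin n × Bool)))
    (hF : ∀ C ∈ F, p ≤ μ.real {ω | SatClause (fun v => X v ω) C}) :
    Integrable (fun ω => (satCount (fun v => X v ω) F : ℝ)) μ ∧
      p * Multiset.card F ≤ ∫ ω, (satCount (fun v => X v ω) F : ℝ) ∂μ := by
  induction F using Multiset.induction_on with
  | empty => simp [satCount]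
  | cons C F ih =>
    obtain ⟨hint, hle⟩ := ih fun D hD => hF D (Multiset.mem_cons_of_mem hD)
    have hC := hF C (Multiset.mem_cons_self C F)
    have hmeas := measurableSet_satClause hX C
    have hind : Integrable ({ω | SatClause (fun v => X v ω) C}.indicator (1 : Ω → ℝ)) μ :=
      (integrable_const 1).indicator hmeas
    have hcons : (fun ω => (satCount (fun v => X v ω) (C ::ₘ F) : ℝ)) = fun ω =>
        (satCount (fun v => X v ω) F : ℝ) +
          {ω | SatClause (fun v => X v ω) C}.indicator (1 : Ω → ℝ) ω := by
      funext ω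
      simp [satCount_cons, Set.indicator_apply]
    rw [hcons]
    refine ⟨hint.add hind, ?_⟩
    rw [integral_add hint hind, integral_indicator_one hmeas, Multiset.card_cons]
    push_cast
    linarith

/-- Under a pairwise independent assignment making every variable true with probability `p`, where
`1 / 2 ≤ p` and `p ^ 2 + p = 1`, a clause that is not a negative unit clause is satisfied with
probability at least `p`. -/
theorem le_measureReal_satClause {n : ℕ} {Ω : Type*} [MeasurableSpace Ω] (μ : Measure Ω)
    [IsProbabilityMeasure μ] {X : Fin n → Ω → Bool} (hX : ∀ v, Measurable (X v))
    (hpair : ∀ v w : Fin n, v ≠ w → ∀ a b : Bool,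
      μ {ω | X v ω = a ∧ X w ω = b} = μ {ω | X v ω = a} * μ {ω | X w ω = b})
    {p : ℝ} (hp : ∀ v, μ.real {ω | X v ω = true} = p) (hhalf : 1 / 2 ≤ p) (hgold : p ^ 2 + p = 1)
    {C : Finset (Fin n × Bool)} (hne : C.Nonempty) (hok : ClauseOK C)
    (hunit : C.card = 1 → ∃ v : Fin n, C = {(v, true)}) :
    p ≤ μ.real {ω | SatClause (fun v => X v ω) C} := by
  have hlit : ∀ v b, μ.real {ω | X v ω = b} ≤ p := by
    intro v b
    cases b with
    | true => exact (hp v).le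
    | false =>
      have hcompl : {ω | X v ω = false} = {ω | X v ω = true}ᶜ := by ext; simp
      have hmeas : MeasurableSet {ω | X v ω = true} := hX v (measurableSet_singleton true)
      rw [hcompl, probReal_compl_eq_one_sub hmeas, hp]
      linarith
  rcases (Finset.one_le_card.mpr hne).eq_or_lt with h1 | h2
  · obtain ⟨v, rfl⟩ := hunit h1.symm
    simp [SatClause, hp]
  · obtain ⟨⟨v, s⟩, hv, ⟨w, t⟩, hw, hvw⟩ := Finset.one_lt_card.mp h2
    have hne' : v ≠ w := by
      rintro rfl
      exact hvw (by rw [hok v s t hv hw])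
    have hsub : {ω | SatClause (fun v => X v ω) C}ᶜ ⊆ {ω | X v ω = !s ∧ X w ω = !t} := by
      intro ω hω
      exact ⟨Bool.eq_not.mpr fun h => hω ⟨_, hv, h⟩, Bool.eq_not.mpr fun h => hω ⟨_, hw, h⟩⟩
    have hle := measureReal_mono (μ := μ) hsub
    have hprod : μ.real {ω | X v ω = !s ∧ X w ω = !t} =
        μ.real {ω | X v ω = !s} * μ.real {ω | X w ω = !t} := by
      simp only [measureReal_def, hpair v w hne', ENNReal.toReal_mul]
    rw [probReal_compl_eq_one_sub (measurableSet_satClause hX C), hprod] at hle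
    have hmul : μ.real {ω | X v ω = !s} * μ.real {ω | X w ω = !t} ≤ p * p :=
      mul_le_mul (hlit _ _) (hlit _ _) measureReal_nonneg (by linarith)
    linarith

theorem stmt_2 {n m : ℕ} (F : Multiset (Finset (Fin n × Bool)))
    (hm : Multiset.card F = m)
    (hne : ∀ C ∈ F, C.Nonempty)
    (hok : ∀ C ∈ F, ClauseOK C)
    (hunit : ∀ C ∈ F, C.card = 1 → ∃ v : Fin n, C = {(v, true)})
    {Ω : Type*} [MeasurableSpace Ω] (μ : Measure Ω) [IsProbabilityMeasure μ]
    (X : Fin n → Ω → Bool) (hX : ∀ v, Measurable (X v))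
    (hpair : ∀ v w : Fin n, v ≠ w → ∀ a b : Bool,
      μ {ω | X v ω = a ∧ X w ω = b} = μ {ω | X v ω = a} * μ {ω | X w ω = b})
    (hp : ∀ v : Fin n, μ {ω | X v ω = true} = ENNReal.ofReal ((Real.sqrt 5 - 1) / 2)) :
    ((Real.sqrt 5 - 1) / 2) * m ≤ ∫ ω, (satCount (fun v => X v ω) F : ℝ) ∂μ := by
  have hsq : Real.sqrt 5 ^ 2 = 5 := Real.sq_sqrt (by norm_num)
  have htwo : 2 ≤ Real.sqrt 5 := Real.le_sqrt_of_sq_le (by norm_num)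
  have hprob : ∀ v, μ.real {ω | X v ω = true} = (Real.sqrt 5 - 1) / 2 := fun v => by
    rw [measureReal_def, hp, ENNReal.toReal_ofReal (by linarith)]
  rw [← hm]
  exact (mul_card_le_integral_satCount μ hX _ F fun C hC =>
    le_measureReal_satClause μ hX hpair hprob (by linarith) (by linarith) (hne C hC) (hok C hC)
      (hunit C hC)).2
end

section
/- Let F be a 2-satisfiable CNF formula over Fin n with m clauses, i.e., each clause is a nonempty finite set of literals containing at most one literal per variable, and there is no variable v such that both the unit clause {(v, true)} and the unit clause {(v, false)} occur in F. Then there exists an assignment φ : Fin n → Bool satisfying at least ((√5 − 1)/2)·m clauses of F. -/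
theorem sum_prod_eq_one {n : ℕ} {p : Fin n → Bool → ℝ} (h1 : ∀ v, ∑ s, p v s = 1) :
    ∑ φ : Fin n → Bool, ∏ v, p v (φ v) = 1 := by
  rw [← Fintype.piFinset_univ, ← Finset.prod_univ_sum]
  simp only [h1, Finset.prod_const_one]

/-- Under a product distribution, the probability of falsifying a clause factors over the
variables. -/
theorem sum_not_satClause {n : ℕ} (p : Fin n → Bool → ℝ) (C : Finset (Fin n × Bool)) :
    ∑ φ : Fin n → Bool, (∏ v, p v (φ v)) * (if SatClause φ C then 0 else 1) =
      ∏ v, ∑ s, (if (v, s) ∈ C then 0 else p v s) := by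
  rw [Finset.prod_univ_sum, Fintype.piFinset_univ]
  refine Finset.sum_congr rfl fun φ _ => ?_
  split_ifs with h
  · obtain ⟨l, hl, hφ⟩ := h
    rw [mul_zero, eq_comm]
    refine Finset.prod_eq_zero (Finset.mem_univ l.1) (if_pos ?_)
    rw [hφ]
    exact hl
  · rw [mul_one]
    refine Finset.prod_congr rfl fun v _ => (if_neg fun hv => h ⟨_, hv, rfl⟩).symm

/-- Under a product distribution giving each literal probability at least `1 - g`, where
`g ^ 2 = 1 - g`, and each unit clause probability at least `g`, every clause is satisfied with
probability at least `g`. -/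
theorem le_sum_satClause {n : ℕ} {g : ℝ} (hg : g ^ 2 = 1 - g)
    {p : Fin n → Bool → ℝ} (h0 : ∀ v s, 0 ≤ p v s) (h1 : ∀ v, ∑ s, p v s = 1)
    (hpg : ∀ v s, 1 - g ≤ p v s) {C : Finset (Fin n × Bool)} (hne : C.Nonempty)
    (hok : ClauseOK C) (hunit : ∀ v s, C = {(v, s)} → g ≤ p v s) :
    g ≤ ∑ φ : Fin n → Bool, (∏ v, p v (φ v)) * (if SatClause φ C then 1 else 0) := by
  have hsplit : ∑ φ : Fin n → Bool, (∏ v, p v (φ v)) * (if SatClause φ C then 1 else 0) +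
      ∑ φ : Fin n → Bool, (∏ v, p v (φ v)) * (if SatClause φ C then 0 else 1) = 1 := by
    rw [← Finset.sum_add_distrib]
    refine (Finset.sum_congr rfl ?_).trans (sum_prod_eq_one h1)
    intro φ _
    split_ifs <;> ring
  rw [sum_not_satClause] at hsplit
  set q : Fin n → ℝ := fun v => ∑ s, (if (v, s) ∈ C then 0 else p v s) with hq
  have hq0 : ∀ v, 0 ≤ q v := fun v => Finset.sum_nonneg fun s _ => by
    split_ifs
    exacts [le_rfl, h0 v s]
  have hq1 : ∀ v, q v ≤ 1 := fun v => by
    rw [← h1 v]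
    refine Finset.sum_le_sum fun s _ => ?_
    split_ifs
    exacts [h0 v s, le_rfl]
  have hqC : ∀ v s, (v, s) ∈ C → q v ≤ 1 - p v s := fun v s hs => by
    have h := h1 v
    have ht := h0 v true
    have hf := h0 v false
    simp only [hq, Fintype.sum_bool] at h ⊢
    cases s <;> simp only [hs, if_true] <;> split_ifs <;> linarith
  suffices h : ∏ v, q v ≤ 1 - g by linarith
  obtain ⟨⟨a, s⟩, ha⟩ := hne
  rw [← Finset.mul_prod_erase _ _ (Finset.mem_univ a)]
  have hqa := hqC a s ha
  by_cases hC : C = {(a, s)}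
  · have := hunit a s hC
    exact (mul_le_of_le_one_right (hq0 a)
      (Finset.prod_le_one (fun v _ => hq0 v) fun v _ => hq1 v)).trans (by linarith)
  · obtain ⟨⟨b, t⟩, hb, hbne⟩ : ∃ l ∈ C, l ≠ (a, s) := by
      by_contra! h
      exact hC (Finset.eq_singleton_iff_unique_mem.2 ⟨ha, h⟩)
    have hba : b ≠ a := by
      rintro rfl
      exact hbne (by rw [hok b t s hb ha])
    rw [← Finset.mul_prod_erase _ _ (Finset.mem_erase.2 ⟨hba, Finset.mem_univ b⟩)]
    have hqa' : q a ≤ g := by linarith [hpg a s]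
    have hqb' : q b ≤ g := by linarith [hqC b t hb, hpg b t]
    calc q a * (q b * _) ≤ q a * q b :=
          mul_le_mul_of_nonneg_left (mul_le_of_le_one_right (hq0 b)
            (Finset.prod_le_one (fun v _ => hq0 v) fun v _ => hq1 v)) (hq0 a)
      _ ≤ g * g := mul_le_mul hqa' hqb' (hq0 b) ((hq0 a).trans hqa')
      _ = 1 - g := by rw [← hg, sq]

theorem card_mul_le_sum_satCount {n : ℕ} {g : ℝ} (w : (Fin n → Bool) → ℝ)
    (F : Multiset (Finset (Fin n × Bool)))
    (h : ∀ C ∈ F, g ≤ ∑ φ, w φ * (if SatClause φ C then 1 else 0)) :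
    g * Multiset.card F ≤ ∑ φ, w φ * satCount φ F := by
  induction F using Multiset.induction_on with
  | empty => simp [satCount]
  | cons C F ih =>
    have hF := ih fun D hD => h D (Multiset.mem_cons_of_mem hD)
    have hC := h C (Multiset.mem_cons_self C F)
    have hsum : ∑ φ, w φ * (satCount φ (C ::ₘ F) : ℝ) =
        ∑ φ, w φ * satCount φ F + ∑ φ, w φ * (if SatClause φ C then 1 else 0) := by
      rw [← Finset.sum_add_distrib]
      refine Finset.sum_congr rfl fun φ _ => ?_
      simp only [satCount, Multiset.countP_cons]
      push_cast
      ring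
    rw [hsum, Multiset.card_cons]
    push_cast
    linarith

theorem stmt_3 {n m : ℕ} (F : Multiset (Finset (Fin n × Bool)))
    (hm : Multiset.card F = m)
    (hne : ∀ C ∈ F, C.Nonempty)
    (hok : ∀ C ∈ F, ClauseOK C)
    (h2sat : ¬ ∃ v : Fin n, ({(v, true)} : Finset (Fin n × Bool)) ∈ F ∧
      ({(v, false)} : Finset (Fin n × Bool)) ∈ F) :
    ∃ φ : Fin n → Bool, ((Real.sqrt 5 - 1) / 2) * m ≤ (satCount φ F : ℝ) := by
  subst hm
  set g : ℝ := (Real.sqrt 5 - 1) / 2 with hgdef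
  have h5 : Real.sqrt 5 ^ 2 = 5 := Real.sq_sqrt (by norm_num)
  have hg : g ^ 2 = 1 - g := by rw [hgdef]; linarith
  have hlo : 1 / 2 ≤ g := by
    have : 2 ≤ Real.sqrt 5 := Real.le_sqrt_of_sq_le (by norm_num)
    rw [hgdef]; linarith
  have hhi : g ≤ 1 := by nlinarith
  let b : Fin n → Bool := fun v => decide (({(v, true)} : Finset (Fin n × Bool)) ∈ F)
  let p : Fin n → Bool → ℝ := fun v s => if s = b v then g else 1 - g
  have hpg : ∀ v s, 1 - g ≤ p v s := fun v s => by
    simp only [p]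
    split_ifs <;> linarith
  have h0 : ∀ v s, 0 ≤ p v s := fun v s => (sub_nonneg.2 hhi).trans (hpg v s)
  have h1 : ∀ v, ∑ s, p v s = 1 := fun v => by
    simp only [p, Fintype.sum_bool]
    cases b v <;> simp
  have hunit : ∀ v s, ({(v, s)} : Finset (Fin n × Bool)) ∈ F → g ≤ p v s := fun v s hs => by
    refine (if_pos ?_).ge
    cases s
    · exact (decide_eq_false fun ht => h2sat ⟨v, ht, hs⟩).symm
    · exact (decide_eq_true hs).symm
  have hF := card_mul_le_sum_satCount (fun φ => ∏ v, p v (φ v)) F fun C hC =>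
    le_sum_satClause hg h0 h1 hpg (hne C hC) (hok C hC) fun v s h => hunit v s (h ▸ hC)
  by_contra! hlt
  have hw : ∀ φ : Fin n → Bool, 0 ≤ ∏ v, p v (φ v) := fun φ =>
    Finset.prod_nonneg fun v _ => h0 v _
  obtain ⟨φ, -, hφ⟩ : ∃ φ ∈ (Finset.univ : Finset (Fin n → Bool)), (0 : ℝ) < ∏ v, p v (φ v) :=
    Finset.exists_lt_of_sum_lt (by simp [sum_prod_eq_one h1])
  have hsum : ∑ φ : Fin n → Bool, (∏ v, p v (φ v)) * (satCount φ F : ℝ) <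
      ∑ φ : Fin n → Bool, (∏ v, p v (φ v)) * (g * Multiset.card F) :=
    Finset.sum_lt_sum (fun ψ _ => mul_le_mul_of_nonneg_left (hlt ψ).le (hw ψ))
      ⟨φ, Finset.mem_univ φ, mul_lt_mul_of_pos_left (hlt φ) hφ⟩
  rw [← Finset.sum_mul, sum_prod_eq_one h1, one_mul] at hsum
  exact hsum.not_ge hF
end

section
/- Let F be a CNF formula over Fin n given as a finite SET of m distinct clauses, each clause being a nonempty finite set of literals containing at most one literal per variable. Let u be the number of variables v such that both unit clauses {(v, true)} and {(v, false)} belong to F. Then there exists an assignment φ : Fin n → Bool satisfying at least ((√5 − 1)/2)·(m − 2u) + u clauses of F. -/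
/-- The probability that a variable takes the value `b` when it takes its preferred value `d`
with probability `p`. -/
def biasedWeight (p : ℝ) (d b : Bool) : ℝ := if b = d then p else 1 - p

/-- The probability that the clause `C` fails when the variables are set independently, each
variable `v` taking its preferred value `d v` with probability `p`. -/
def failProb {n : ℕ} (p : ℝ) (d : Fin n → Bool) (C : Finset (Fin n × Bool)) : ℝ :=
  ∏ v, ∑ b, if (v, b) ∈ C then 0 else biasedWeight p (d v) b

lemma sum_biasedWeight (p : ℝ) (d : Bool) : ∑ b, biasedWeight p d b = 1 := by
  cases d <;> simp [biasedWeight]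

lemma biasedWeight_pos {p : ℝ} (h0 : 0 < p) (h1 : p < 1) (d b : Bool) :
    0 < biasedWeight p d b := by
  unfold biasedWeight
  split_ifs <;> linarith

lemma sum_prod_biasedWeight {n : ℕ} (p : ℝ) (d : Fin n → Bool) :
    ∑ φ : Fin n → Bool, ∏ v, biasedWeight p (d v) (φ v) = 1 := by
  rw [← Fintype.piFinset_univ, ← Finset.prod_univ_sum]
  simp only [sum_biasedWeight, Finset.prod_const_one]

lemma failProb_eq_sum {n : ℕ} (p : ℝ) (d : Fin n → Bool) (C : Finset (Fin n × Bool)) :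
    failProb p d C = ∑ φ : Fin n → Bool,
      (∏ v, biasedWeight p (d v) (φ v)) * (if SatClause φ C then 0 else 1) := by
  rw [failProb, Finset.prod_univ_sum, Fintype.piFinset_univ]
  refine Finset.sum_congr rfl fun φ _ => ?_
  split_ifs with h
  · obtain ⟨⟨v, s⟩, hl, hs⟩ := h
    rw [mul_zero]
    refine Finset.prod_eq_zero (Finset.mem_univ v) ?_
    simp only at hs
    rw [if_pos (by rwa [hs])]
  · rw [mul_one]
    refine Finset.prod_congr rfl fun v _ => ?_
    rw [if_neg fun hv => h ⟨(v, φ v), hv, rfl⟩]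

lemma failProb_singleton {n : ℕ} (p : ℝ) (d : Fin n → Bool) (v : Fin n) (s : Bool) :
    failProb p d {(v, s)} = 1 - biasedWeight p (d v) s := by
  have hs := sum_biasedWeight p (d v)
  rw [failProb, Finset.prod_eq_single v]
  · rw [Fintype.sum_bool] at hs ⊢
    cases s <;> simp <;> linarith
  · intro w _ hw
    simpa [hw] using sum_biasedWeight p (d w)
  · simp

/-- A clause with literals on two distinct variables fails with probability at most `p ^ 2`. -/
lemma failProb_le_sq {n : ℕ} {p : ℝ} (h0 : 1 / 2 ≤ p) (h1 : p < 1) (d : Fin n → Bool)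
    {C : Finset (Fin n × Bool)} {v w : Fin n} {s t : Bool} (hv : (v, s) ∈ C) (hw : (w, t) ∈ C)
    (hvw : v ≠ w) : failProb p d C ≤ p ^ 2 := by
  have hpos := biasedWeight_pos (p := p) (by linarith) h1
  have nonneg : ∀ x, 0 ≤ ∑ b, if (x, b) ∈ C then 0 else biasedWeight p (d x) b := fun x =>
    Finset.sum_nonneg fun b _ => by split_ifs <;> simp [(hpos (d x) b).le]
  have le_one : ∀ x, (∑ b, if (x, b) ∈ C then 0 else biasedWeight p (d x) b) ≤ 1 := fun x => by
    rw [← sum_biasedWeight p (d x)]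
    exact Finset.sum_le_sum fun b _ => by split_ifs <;> simp [(hpos (d x) b).le]
  have le_p : ∀ x r, (x, r) ∈ C →
      (∑ b, if (x, b) ∈ C then 0 else biasedWeight p (d x) b) ≤ p := fun x r hx => by
    rw [Fintype.sum_bool]
    cases r <;> simp only [hx, if_true, biasedWeight] <;> split_ifs <;> linarith
  rw [failProb, ← Finset.mul_prod_erase _ _ (Finset.mem_univ v),
    ← Finset.mul_prod_erase _ _ (Finset.mem_erase.2 ⟨hvw.symm, Finset.mem_univ w⟩), sq]
  refine mul_le_mul (le_p v s hv) ?_ (mul_nonneg (nonneg w) ?_) (by linarith)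
  · exact (mul_le_of_le_one_right (nonneg w)
      (Finset.prod_le_one (fun x _ => nonneg x) fun x _ => le_one x)).trans (le_p w t hw)
  · exact Finset.prod_nonneg fun x _ => nonneg x

/-- Some assignment satisfies at least the expected number of clauses. -/
lemma exists_expectation_le_card_sat {n : ℕ} {p : ℝ} (h0 : 0 < p) (h1 : p < 1)
    (d : Fin n → Bool) (F : Finset (Finset (Fin n × Bool))) :
    ∃ φ : Fin n → Bool, ∑ C ∈ F, (1 - failProb p d C) ≤ ((F.filter (SatClause φ)).card : ℝ) := by
  set W : (Fin n → Bool) → ℝ := fun φ => ∏ v, biasedWeight p (d v) (φ v) with hW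
  have hsum : ∑ φ, W φ = 1 := sum_prod_biasedWeight p d
  have key : ∑ φ, W φ * ∑ C ∈ F, (1 - failProb p d C) ≤
      ∑ φ, W φ * ((F.filter (SatClause φ)).card : ℝ) := by
    rw [← Finset.sum_mul, hsum, one_mul]
    simp only [Finset.card_filter, Nat.cast_sum, Finset.mul_sum]
    rw [Finset.sum_comm]
    refine Finset.sum_le_sum fun C _ => ?_
    nth_rewrite 1 [failProb_eq_sum, ← hsum]
    rw [← Finset.sum_sub_distrib]
    refine Finset.sum_le_sum fun φ _ => ?_
    split_ifs <;> simp [hW]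
  obtain ⟨φ, -, hφ⟩ := Finset.exists_le_of_sum_le Finset.univ_nonempty key
  exact ⟨φ, le_of_mul_le_mul_left hφ (Finset.prod_pos fun v _ => biasedWeight_pos h0 h1 _ _)⟩

theorem stmt_4 {n m : ℕ} (F : Finset (Finset (Fin n × Bool)))
    (hm : F.card = m)
    (hne : ∀ C ∈ F, C.Nonempty)
    (hok : ∀ C ∈ F, ClauseOK C)
    (u : ℕ)
    (hu : u = (Finset.univ.filter (fun v : Fin n =>
      ({(v, true)} : Finset (Fin n × Bool)) ∈ F ∧
        ({(v, false)} : Finset (Fin n × Bool)) ∈ F)).card) :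
    ∃ φ : Fin n → Bool,
      ((Real.sqrt 5 - 1) / 2) * ((m : ℝ) - 2 * u) + u ≤
        ((F.filter (SatClause φ)).card : ℝ) := by
  have h5 : Real.sqrt 5 ^ 2 = 5 := Real.sq_sqrt (by norm_num)
  have h5l : 2 ≤ Real.sqrt 5 := Real.le_sqrt_of_sq_le (by norm_num)
  have h5u : Real.sqrt 5 < 3 := by nlinarith
  set p : ℝ := (Real.sqrt 5 - 1) / 2 with hp
  have hp0 : 1 / 2 ≤ p := by linarith
  have hp1 : p < 1 := by linarith
  have hp2 : p ^ 2 = 1 - p := by rw [hp]; nlinarith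
  set d : Fin n → Bool := fun v => decide (({(v, true)} : Finset (Fin n × Bool)) ∈ F) with hd
  obtain ⟨φ, hφ⟩ := exists_expectation_le_card_sat (by linarith) hp1 d F
  refine ⟨φ, le_trans ?_ hφ⟩
  set V := Finset.univ.filter (fun v : Fin n =>
    ({(v, true)} : Finset (Fin n × Bool)) ∈ F ∧ ({(v, false)} : Finset (Fin n × Bool)) ∈ F) with hV
  set B := (V ×ˢ (Finset.univ : Finset Bool)).image
    (fun l => ({l} : Finset (Fin n × Bool))) with hB
  have hBF : B ⊆ F := by
    intro C hC
    simp only [hB, hV, Finset.mem_image, Finset.mem_product, Finset.mem_filter] at hC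
    obtain ⟨⟨v, s⟩, ⟨⟨-, ht, hf⟩, -⟩, rfl⟩ := hC
    cases s
    · exact hf
    · exact ht
  have hsumB : ∑ C ∈ B, (1 - failProb p d C - p) = u * (1 - 2 * p) := by
    rw [hB, Finset.sum_image fun a _ b _ h => Finset.singleton_injective h, Finset.sum_product,
      hu, ← nsmul_eq_mul, ← Finset.sum_const]
    refine Finset.sum_congr rfl fun v _ => ?_
    have := sum_biasedWeight p (d v)
    rw [Fintype.sum_bool] at this ⊢
    rw [failProb_singleton, failProb_singleton]
    linarith
  have hle : ∑ C ∈ B, (1 - failProb p d C - p) ≤ ∑ C ∈ F, (1 - failProb p d C - p) := by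
    refine Finset.sum_le_sum_of_subset_of_nonneg hBF fun C hC hCB => ?_
    obtain ⟨⟨v, s⟩, hv⟩ := hne C hC
    by_cases hw : ∃ l ∈ C, l.1 ≠ v
    · obtain ⟨⟨w, t⟩, hw, hwv⟩ := hw
      have := failProb_le_sq hp0 hp1 d hv hw (Ne.symm hwv)
      linarith
    · push Not at hw
      obtain rfl : C = {(v, s)} := by
        refine Finset.eq_singleton_iff_unique_mem.2 ⟨hv, ?_⟩
        rintro ⟨w, t⟩ hwt
        obtain rfl : w = v := hw _ hwt
        rw [hok C hC w t s hwt hv]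
      have hds : s = d v := by
        cases s
        · have : ({(v, true)} : Finset (Fin n × Bool)) ∉ F := fun ht => hCB <|
            Finset.mem_image.2 ⟨(v, false), by simp [hV, ht, hC], rfl⟩
          simp [hd, this]
        · simp [hd, hC]
      rw [failProb_singleton, biasedWeight, if_pos hds]
      linarith
  rw [hsumB, Finset.sum_sub_distrib _ (fun _ => p), Finset.sum_const, hm, nsmul_eq_mul] at hle
  linarith
end

section
/- Let G be a simple graph on a vertex type V, let u ∈ V, let k ≥ 1 and i ∈ {0, …, k−1}, and let W_i = { v ∈ V : v is reachable from u and there exists j ∈ ℕ with j ≡ i (mod k) and dist(u, v) ∈ {2j, 2j+1, 2j+2} }. Suppose a and b are vertices reachable from u and there is a walk from a to b in G that avoids all vertices of W_i. Then for every j ∈ ℕ with j ≡ i (mod k), dist(u, a) < 2j if and only if dist(u, b) < 2j; in other words, no removed block of levels {2j, 2j+1, 2j+2} with j ≡ i (mod k) separates the distance levels of a and b, so every connected component of the graph with W_i removed is confined to the band of BFS levels strictly between two consecutive removed blocks. -/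
theorem SimpleGraph.Reachable.dist_le_dist_add_one_of_adj {V : Type*} {G : SimpleGraph V}
    {u v w : V} (huv : G.Reachable u v) (h : G.Adj v w) : G.dist u w ≤ G.dist u v + 1 := by
  obtain ⟨q, hq⟩ := huv.exists_walk_length_eq_dist
  simpa [hq] using SimpleGraph.dist_le (q.concat h)

/-- A walk that avoids the distance level `n` from `u` stays on one side of it. -/
theorem SimpleGraph.Walk.dist_lt_iff_of_avoids {V : Type*} {G : SimpleGraph V} {u a b : V} {n : ℕ}
    (p : G.Walk a b) (hua : G.Reachable u a)
    (hp : ∀ x ∈ p.support, G.dist u x ≠ n) :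
    G.dist u a < n ↔ G.dist u b < n := by
  induction p with
  | nil => rfl
  | @cons a c b h q ih =>
    have huc : G.Reachable u c := hua.trans h.reachable
    rw [← ih huc fun x hx => hp x (by simp [hx])]
    have hac := hua.dist_le_dist_add_one_of_adj h
    have hca := huc.dist_le_dist_add_one_of_adj h.symm
    have ha := hp a (by simp)
    have hc := hp c (by simp)
    omega

theorem stmt_15 {V : Type*} (G : SimpleGraph V) (u : V) {k : ℕ} (hk : 1 ≤ k)
    {i : ℕ} (hi : i < k) {a b : V}
    (hua : G.Reachable u a) (hub : G.Reachable u b)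
    (W : Set V)
    (hW : W = {v : V | G.Reachable u v ∧ ∃ j : ℕ, j % k = i ∧
      (G.dist u v = 2 * j ∨ G.dist u v = 2 * j + 1 ∨ G.dist u v = 2 * j + 2)})
    (p : G.Walk a b) (hp : ∀ x ∈ p.support, x ∉ W) :
    ∀ j : ℕ, j % k = i → (G.dist u a < 2 * j ↔ G.dist u b < 2 * j) := by
  subst hW
  intro j hj
  refine p.dist_lt_iff_of_avoids hua fun x hx => ?_
  have hux : G.Reachable u x := by
    classical exact hua.trans (p.takeUntil x hx).reachable
  exact fun h => hp x hx ⟨hux, j, hj, Or.inl h⟩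
end
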